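/- arXiv:1306.6288 — 3 statements merged into one kernel-verified Lean document; each statement's English description precedes it below -/
import Mathlib

section
/- In the single-letter JSCC setup, suppose A ⊆ S, δ ≥ 0, and reals R, γ, k satisfy the sphere-packing bound: for every ŝ ∈ Ŝ, P(S ∈ A and d(S, ŝ) ≤ δ) ≤ 2^{−n(R + k)}. Then P({i(S,Y) ≤ R − γ} ∩ {d(S, g(Y)) ≤ δ} ∩ {S ∈ A}) ≤ 2^{−n(γ + k)}. -/
open scoped BigOperators

/-- Probability of an event under a PMF on a finite type. -/
noncomputable def srcPr {S : Type*} [Fintype S] (p : PMF S) (E : Set S) : ℝ :=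
  ∑ s, E.indicator (fun s => (p s).toReal) s

/-- Probability of an event for the joint law `P(s, y) = p(s) · W(e(s))(y)`
of the source and the channel output. -/
noncomputable def jointPr {S X Y : Type*} [Fintype S] [Fintype Y]
    (p : PMF S) (W : X → PMF Y) (e : S → X) (E : Set (S × Y)) : ℝ :=
  ∑ s, ∑ y, E.indicator (fun sy => (p sy.1 * W (e sy.1) sy.2).toReal) (s, y)

/-- The output marginal `q(y) = ∑ s, p(s) · W(e(s))(y)`. -/
noncomputable def outQ {S X Y : Type*} [Fintype S]
    (p : PMF S) (W : X → PMF Y) (e : S → X) (y : Y) : ℝ :=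
  ∑ s, (p s * W (e s) y).toReal

/-- The normalized information density `i(s; y) = (1/n) log₂ (W(e(s))(y) / q(y))`. -/
noncomputable def infoDensity {S X Y : Type*} [Fintype S]
    (n : ℕ) (p : PMF S) (W : X → PMF Y) (e : S → X) (s : S) (y : Y) : ℝ :=
  (1 / (n : ℝ)) * Real.logb 2 ((W (e s) y).toReal / outQ p W e y)

/-- A nonzero source-output pair has channel likelihood at most `q(y) · 2^{nt}` whenever its
information density is at most `t`. -/
theorem toReal_le_outQ_mul_two_rpow {S X Y : Type*} [Fintype S] {n : ℕ} (hn : 1 ≤ n)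
    (p : PMF S) (W : X → PMF Y) (e : S → X) {s : S} {y : Y} {t : ℝ}
    (hpos : 0 < (p s * W (e s) y).toReal) (h : infoDensity n p W e s y ≤ t) :
    (W (e s) y).toReal ≤ outQ p W e y * 2 ^ ((n : ℝ) * t) := by
  have hn' : (0 : ℝ) < n := by exact_mod_cast hn
  have hq : 0 < outQ p W e y := hpos.trans_le
    (Finset.single_le_sum (f := fun s => (p s * W (e s) y).toReal)
      (fun _ _ => ENNReal.toReal_nonneg) (Finset.mem_univ s))
  have hw : 0 < (W (e s) y).toReal := by
    rw [ENNReal.toReal_mul] at hpos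
    exact pos_of_mul_pos_right hpos ENNReal.toReal_nonneg
  have hlog : Real.logb 2 ((W (e s) y).toReal / outQ p W e y) ≤ n * t := by
    rw [infoDensity, one_div, inv_mul_le_iff₀ hn'] at h
    exact h
  rw [Real.logb_le_iff_le_rpow one_lt_two (div_pos hw hq), div_le_iff₀ hq] at hlog
  linarith

theorem sum_toReal_eq_one {α : Type*} [Fintype α] (p : PMF α) : ∑ a, (p a).toReal = 1 := by
  rw [← ENNReal.toReal_sum fun a _ => p.apply_ne_top a, ← tsum_fintype (L := .unconditional α),
    p.tsum_coe, ENNReal.toReal_one]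

theorem sum_outQ_eq_one {S X Y : Type*} [Fintype S] [Fintype Y]
    (p : PMF S) (W : X → PMF Y) (e : S → X) : ∑ y, outQ p W e y = 1 := by
  simp only [outQ, ENNReal.toReal_mul]
  rw [Finset.sum_comm]
  simp only [← Finset.mul_sum, sum_toReal_eq_one, mul_one]

/-- Key estimate in the JSCC converse lemma: under the sphere-packing bound, the event
`{i(S,Y) ≤ R − γ} ∩ {d(S, g(Y)) ≤ δ} ∩ {S ∈ A}` has probability at most `2^{−n(γ+k)}`. -/
theorem jscc_converse_key_bound
    {S X Y Sh : Type*} [Fintype S] [Nonempty S] [Fintype X] [Nonempty X]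
    [Fintype Y] [Nonempty Y] [Fintype Sh] [Nonempty Sh]
    (n : ℕ) (hn : 1 ≤ n)
    (p : PMF S) (W : X → PMF Y) (e : S → X) (g : Y → Sh)
    (d : S → Sh → ℝ) (hd : ∀ s sh, 0 ≤ d s sh)
    (A : Set S) (δ : ℝ) (hδ : 0 ≤ δ) (R γ k : ℝ)
    (hSPO : ∀ sh : Sh, srcPr p {s | s ∈ A ∧ d s sh ≤ δ} ≤ 2 ^ (-(n : ℝ) * (R + k))) :
    jointPr p W e
      {sy | infoDensity n p W e sy.1 sy.2 ≤ R - γ ∧ d sy.1 (g sy.2) ≤ δ ∧ sy.1 ∈ A}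
      ≤ 2 ^ (-(n : ℝ) * (γ + k)) := by
  have hq (y : Y) : 0 ≤ outQ p W e y := Finset.sum_nonneg fun _ _ => ENNReal.toReal_nonneg
  have hterm (s : S) (y : Y) :
      Set.indicator {sy : S × Y | infoDensity n p W e sy.1 sy.2 ≤ R - γ ∧
          d sy.1 (g sy.2) ≤ δ ∧ sy.1 ∈ A}
        (fun sy => (p sy.1 * W (e sy.1) sy.2).toReal) (s, y) ≤
      outQ p W e y * 2 ^ ((n : ℝ) * (R - γ)) *
        Set.indicator {s | s ∈ A ∧ d s (g y) ≤ δ} (fun s => (p s).toReal) s := by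
    refine Set.indicator_le' (f := fun sy : S × Y => (p sy.1 * W (e sy.1) sy.2).toReal)
      (g := fun sy : S × Y => outQ p W e sy.2 * 2 ^ ((n : ℝ) * (R - γ)) *
        Set.indicator {s | s ∈ A ∧ d s (g sy.2) ≤ δ} (fun s => (p s).toReal) sy.1)
      ?_ ?_ (s, y)
    · rintro ⟨s, y⟩ ⟨hi, hdist, hA⟩
      rw [Set.indicator_of_mem (show s ∈ {s | s ∈ A ∧ d s (g y) ≤ δ} from ⟨hA, hdist⟩)]
      rcases (ENNReal.toReal_nonneg (a := p s * W (e s) y)).eq_or_lt with h0 | hpos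
      · simp only [← h0]
        exact mul_nonneg (mul_nonneg (hq y) (by positivity)) ENNReal.toReal_nonneg
      · have := toReal_le_outQ_mul_two_rpow hn p W e hpos hi
        simp only [ENNReal.toReal_mul]
        rw [mul_comm]
        gcongr
    · rintro ⟨s, y⟩ -
      exact mul_nonneg (mul_nonneg (hq y) (by positivity))
        (Set.indicator_nonneg (fun _ _ => ENNReal.toReal_nonneg) s)
  calc _ ≤ ∑ s, ∑ y, outQ p W e y * 2 ^ ((n : ℝ) * (R - γ)) *
        Set.indicator {s | s ∈ A ∧ d s (g y) ≤ δ} (fun s => (p s).toReal) s :=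
        Finset.sum_le_sum fun s _ => Finset.sum_le_sum fun y _ => hterm s y
    _ = ∑ y, outQ p W e y * 2 ^ ((n : ℝ) * (R - γ)) *
        srcPr p {s | s ∈ A ∧ d s (g y) ≤ δ} := by
        rw [Finset.sum_comm]
        simp only [srcPr, Finset.mul_sum]
    _ ≤ ∑ y, outQ p W e y * 2 ^ ((n : ℝ) * (R - γ)) * 2 ^ (-(n : ℝ) * (R + k)) :=
        Finset.sum_le_sum fun y _ => mul_le_mul_of_nonneg_left (hSPO (g y))
          (mul_nonneg (hq y) (by positivity))
    _ = 2 ^ (-(n : ℝ) * (γ + k)) := by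
        simp only [mul_assoc]
        rw [← Finset.sum_mul, sum_outQ_eq_one, one_mul, ← Real.rpow_add two_pos]
        ring_nf
end

section
/- (Gaussian sphere-packing bound) Let n ≥ 1, σ > 0, ε ≥ 0, and let X₁, …, Xₙ be i.i.d. Gaussian random variables with mean 0 and variance σ². Then for every y ∈ ℝⁿ and every D > 0, P( |(1/n)·Σᵢ Xᵢ² − σ²| ≤ ε and (1/n)·Σᵢ (Xᵢ − yᵢ)² ≤ D ) ≤ (D/σ²)^{n/2} · e^{nε/(2σ²)}. -/
open scoped BigOperators NNReal
open MeasureTheory ProbabilityTheory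

/-- A product of probability measures with densities has the product density. -/
lemma pi_withDensity_of_isProbabilityMeasure {ι : Type*} [Fintype ι] {α : ι → Type*}
    [∀ i, MeasurableSpace (α i)] (ν : ∀ i, Measure (α i)) [∀ i, IsProbabilityMeasure (ν i)]
    {f : ∀ i, α i → ENNReal} (hf : ∀ i, Measurable (f i))
    [∀ i, SigmaFinite ((ν i).withDensity (f i))] :
    Measure.pi (fun i => (ν i).withDensity (f i)) =
      (Measure.pi ν).withDensity fun x => ∏ i, f i (x i) := by
  refine Measure.pi_eq fun s hs => ?_
  have hind : ∀ x : ∀ i, α i, (Set.univ.pi s).indicator (fun x => ∏ i, f i (x i)) x =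
      ∏ i, (s i).indicator (f i) (x i) := fun x => by
    classical
    by_cases hx : x ∈ Set.univ.pi s
    · rw [Set.indicator_of_mem hx]
      exact Finset.prod_congr rfl fun i _ => (Set.indicator_of_mem (hx i trivial) _).symm
    · rw [Set.indicator_of_notMem hx]
      simp only [Set.mem_pi, Set.mem_univ, true_imp_iff, not_forall] at hx
      obtain ⟨i, hi⟩ := hx
      exact (Finset.prod_eq_zero (Finset.mem_univ i) (Set.indicator_of_notMem hi _)).symm
  have hm : ∀ i, Measurable ((s i).indicator (f i)) := fun i => (hf i).indicator (hs i)
  rw [withDensity_apply _ (MeasurableSet.univ_pi hs),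
    ← lintegral_indicator (MeasurableSet.univ_pi hs), lintegral_congr hind,
    lintegral_prod_eq_prod_lintegral_of_indepFun Finset.univ
      (fun i (x : ∀ i, α i) => (s i).indicator (f i) (x i))
      (iIndepFun_pi fun i => (hm i).aemeasurable)
      fun i => (hm i).comp (measurable_pi_apply i)]
  refine Finset.prod_congr rfl fun i _ => ?_
  rw [(measurePreserving_eval ν i).lintegral_comp (hm i), lintegral_indicator (hs i),
    withDensity_apply _ (hs i)]

/-- The likelihood ratio between two nondegenerate real Gaussian measures. -/
lemma gaussianReal_eq_withDensity_gaussianReal (μ m : ℝ) {v w : ℝ≥0} (hv : v ≠ 0) (hw : w ≠ 0) :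
    gaussianReal μ v = (gaussianReal m w).withDensity fun x =>
      ENNReal.ofReal (√((w : ℝ) / v) *
        Real.exp ((x - m) ^ 2 / (2 * w) - (x - μ) ^ 2 / (2 * v))) := by
  rw [gaussianReal_of_var_ne_zero μ hv, gaussianReal_of_var_ne_zero m hw,
    ← withDensity_mul _ (measurable_gaussianPDF m w) (by fun_prop)]
  congr 1
  ext x
  have hv' : (0 : ℝ) < v := by positivity
  have hw' : (0 : ℝ) < w := by positivity
  rw [Pi.mul_apply, gaussianPDF, gaussianPDF, ← ENNReal.ofReal_mul (gaussianPDFReal_nonneg _ _ _)]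
  congr 1
  simp only [gaussianPDFReal]
  rw [mul_mul_mul_comm, ← Real.exp_add, ← Real.sqrt_inv, ← Real.sqrt_inv,
    ← Real.sqrt_mul (by positivity)]
  congr 2
  · field_simp
  · ring

/-- Gaussian sphere-packing bound: for i.i.d. `N(0, σ²)` variables `X₁, …, Xₙ`,
every center `y ∈ ℝⁿ` and every `D > 0`,
`P(|(1/n)∑ Xᵢ² − σ²| ≤ ε ∧ (1/n)∑ (Xᵢ − yᵢ)² ≤ D) ≤ (D/σ²)^{n/2} · e^{nε/(2σ²)}`. -/
theorem gaussian_sphere_packing_bound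
    (n : ℕ) (hn : 1 ≤ n) (σ : ℝ) (hσ : 0 < σ) (ε : ℝ) (hε : 0 ≤ ε)
    (y : Fin n → ℝ) (D : ℝ) (hD : 0 < D) :
    ((Measure.pi fun _ : Fin n => gaussianReal 0 ⟨σ ^ 2, sq_nonneg σ⟩)
        {x : Fin n → ℝ |
          |(1 / (n : ℝ)) * ∑ i, (x i) ^ 2 - σ ^ 2| ≤ ε ∧
          (1 / (n : ℝ)) * ∑ i, (x i - y i) ^ 2 ≤ D}).toReal
      ≤ (D / σ ^ 2) ^ ((n : ℝ) / 2) * Real.exp ((n : ℝ) * ε / (2 * σ ^ 2)) := by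
  have hn' : (0 : ℝ) < n := by exact_mod_cast hn
  set v : ℝ≥0 := ⟨σ ^ 2, sq_nonneg σ⟩
  have hv_coe : (v : ℝ) = σ ^ 2 := rfl
  have hv : v ≠ 0 := by
    rw [← NNReal.coe_ne_zero, hv_coe]
    positivity
  set w : ℝ≥0 := ⟨D, hD.le⟩
  have hw_coe : (w : ℝ) = D := rfl
  have hw : w ≠ 0 := by
    rw [← NNReal.coe_ne_zero, hw_coe]
    exact hD.ne'
  set r : Fin n → ℝ → ENNReal := fun i x =>
    ENNReal.ofReal (√((w : ℝ) / v) *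
      Real.exp ((x - y i) ^ 2 / (2 * w) - (x - 0) ^ 2 / (2 * v))) with hr
  have hr_eq : ∀ i, gaussianReal 0 v = (gaussianReal (y i) w).withDensity (r i) := fun i =>
    gaussianReal_eq_withDensity_gaussianReal 0 (y i) hv hw
  have hr_meas : ∀ i, Measurable (r i) := fun i => by fun_prop
  have : ∀ i, SigmaFinite ((gaussianReal (y i) w).withDensity (r i)) := fun i => by
    rw [← hr_eq i]
    infer_instance
  have hpi : Measure.pi (fun _ : Fin n => gaussianReal 0 v) =
      (Measure.pi fun i => gaussianReal (y i) w).withDensity fun x => ∏ i, r i (x i) := by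
    rw [← pi_withDensity_of_isProbabilityMeasure _ hr_meas]
    exact congrArg Measure.pi (funext hr_eq)
  refine ENNReal.toReal_le_of_le_ofReal (by positivity) ?_
  rw [hpi, withDensity_apply']
  set C : ENNReal := ENNReal.ofReal
    ((D / σ ^ 2) ^ ((n : ℝ) / 2) * Real.exp ((n : ℝ) * ε / (2 * σ ^ 2))) with hC
  refine (setLIntegral_mono (g := fun _ => C) measurable_const ?_).trans ?_
  · rintro x ⟨hx, hxy⟩
    have hx_lower : (n : ℝ) * (σ ^ 2 - ε) ≤ ∑ i, x i ^ 2 := by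
      have h := (abs_le.mp hx).1
      rw [one_div, inv_mul_eq_div] at h
      rw [mul_comm, ← le_div_iff₀ hn']
      linarith
    have hxy_upper : ∑ i, (x i - y i) ^ 2 ≤ n * D := by
      rwa [one_div, inv_mul_eq_div, div_le_iff₀' hn'] at hxy
    rw [hr, hC, ← ENNReal.ofReal_prod_of_nonneg fun i _ => by positivity]
    refine ENNReal.ofReal_le_ofReal ?_
    rw [Finset.prod_mul_distrib, ← Real.exp_sum, Finset.prod_const, Finset.card_univ,
      Fintype.card_fin, Real.sqrt_eq_rpow, ← Real.rpow_mul_natCast (by positivity),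
      hw_coe, hv_coe, one_div_mul_eq_div]
    gcongr
    rw [Finset.sum_sub_distrib, ← Finset.sum_div, ← Finset.sum_div]
    simp only [sub_zero]
    calc (∑ i, (x i - y i) ^ 2) / (2 * D) - (∑ i, x i ^ 2) / (2 * σ ^ 2)
        ≤ n * D / (2 * D) - n * (σ ^ 2 - ε) / (2 * σ ^ 2) := by gcongr
      _ = n * ε / (2 * σ ^ 2) := by
        field_simp
        ring
  · rw [setLIntegral_const]
    exact mul_le_of_le_one_right' prob_le_one
end

section
/- (The Gaussian source is sphere-packing optimal) Let σ > 0 and, for each n ≥ 1, let X⁽ⁿ⁾ = (X₁, …, Xₙ) be i.i.d. Gaussian with mean 0 and variance σ². Define R : (0,∞) → ℝ by R(d) = max(0, (1/2)·log₂(σ²/d)). Then there exist measurable sets Aₙ ⊆ ℝⁿ and real numbers kₙ → 0 such that P(X⁽ⁿ⁾ ∉ Aₙ) → 0 as n → ∞, and for every n ≥ 1, every d > 0, and every y ∈ ℝⁿ, P( X⁽ⁿ⁾ ∈ Aₙ and (1/n)·Σᵢ (Xᵢ − yᵢ)² ≤ d ) ≤ 2^{−n(R(d) + kₙ)}. -/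
open scoped BigOperators NNReal
open MeasureTheory ProbabilityTheory Filter

/-- A finite product of nondegenerate Gaussian measures has the product of the Gaussian densities
as its density. -/
theorem pi_gaussianReal_eq_withDensity {ι : Type*} [Fintype ι] (m : ι → ℝ) {v : ι → ℝ≥0}
    (hv : ∀ i, v i ≠ 0) :
    (Measure.pi fun i => gaussianReal (m i) (v i)) =
      volume.withDensity fun x => ENNReal.ofReal (∏ i, gaussianPDFReal (m i) (v i) (x i)) := by
  refine Measure.pi_eq fun s hs => ?_
  have hbox : (volume : Measure (ι → ℝ)).restrict (Set.univ.pi s) =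
      Measure.pi fun i => (volume : Measure ℝ).restrict (s i) := by
    rw [volume_pi, Measure.restrict_pi_pi]
  rw [withDensity_apply _ (MeasurableSet.univ_pi hs), hbox,
    ← ofReal_integral_eq_lintegral_ofReal
      (Integrable.fintype_prod_dep fun i => (integrable_gaussianPDFReal (m i) (v i)).restrict)
      (ae_of_all _ fun x => Finset.prod_nonneg fun i _ => gaussianPDFReal_nonneg _ _ _),
    integral_fintype_prod_eq_prod (f := fun i => gaussianPDFReal (m i) (v i)),
    ENNReal.ofReal_prod_of_nonneg fun i _ => integral_nonneg fun x => gaussianPDFReal_nonneg _ _ _]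
  exact Finset.prod_congr rfl fun i _ => (gaussianReal_apply_eq_integral _ (hv i) _).symm

/-- Changing the mean and the variance of a Gaussian density. -/
theorem gaussianPDFReal_eq_exp_mul (m m' x : ℝ) {v w : ℝ≥0} (hv : v ≠ 0) (hw : w ≠ 0) :
    gaussianPDFReal m v x =
      Real.exp ((x - m') ^ 2 / (2 * w) - (x - m) ^ 2 / (2 * v) + Real.log (w / v) / 2) *
        gaussianPDFReal m' w x := by
  have hv' : (0 : ℝ) < v := by exact_mod_cast pos_iff_ne_zero.2 hv
  have hw' : (0 : ℝ) < w := by exact_mod_cast pos_iff_ne_zero.2 hw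
  have hs : Real.exp (Real.log (w / v) / 2) = √(2 * Real.pi * w) / √(2 * Real.pi * v) := by
    rw [← Real.log_sqrt (by positivity), Real.exp_log (by positivity),
      ← Real.sqrt_div (by positivity)]
    congr 1
    field_simp
  have hw'' : √(2 * Real.pi * w) ≠ 0 := by positivity
  simp only [gaussianPDFReal, Real.exp_add, Real.exp_sub, hs, neg_div, Real.exp_neg]
  field_simp

/-- If the log-density ratio of two Gaussian product measures is at most `T` on `S`, then the first
measure of `S` is at most `exp T`. -/
theorem pi_gaussianReal_toReal_le {ι : Type*} [Fintype ι] {v w : ℝ≥0} (hv : v ≠ 0) (hw : w ≠ 0)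
    (m y : ι → ℝ) {S : Set (ι → ℝ)} (hS : MeasurableSet S) (T : ℝ)
    (hT : ∀ x ∈ S, (∑ i, (x i - y i) ^ 2) / (2 * w) - (∑ i, (x i - m i) ^ 2) / (2 * v) +
      Fintype.card ι * (Real.log (w / v) / 2) ≤ T) :
    ((Measure.pi fun i => gaussianReal (m i) v) S).toReal ≤ Real.exp T := by
  refine ENNReal.toReal_le_of_le_ofReal (Real.exp_pos T).le ?_
  have hratio : ∀ x ∈ S, ENNReal.ofReal (∏ i, gaussianPDFReal (m i) v (x i)) ≤
      ENNReal.ofReal (Real.exp T) * ENNReal.ofReal (∏ i, gaussianPDFReal (y i) w (x i)) := by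
    intro x hx
    rw [← ENNReal.ofReal_mul (Real.exp_pos T).le]
    refine ENNReal.ofReal_le_ofReal ?_
    have hprod : 0 ≤ ∏ i, gaussianPDFReal (y i) w (x i) :=
      Finset.prod_nonneg fun i _ => gaussianPDFReal_nonneg _ _ _
    calc ∏ i, gaussianPDFReal (m i) v (x i)
        = Real.exp ((∑ i, (x i - y i) ^ 2) / (2 * w) - (∑ i, (x i - m i) ^ 2) / (2 * v) +
            Fintype.card ι * (Real.log (w / v) / 2)) * ∏ i, gaussianPDFReal (y i) w (x i) := by
          rw [Finset.prod_congr rfl fun i _ => gaussianPDFReal_eq_exp_mul (m i) (y i) (x i) hv hw,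
            Finset.prod_mul_distrib, ← Real.exp_sum, Finset.sum_add_distrib,
            Finset.sum_sub_distrib, Finset.sum_div, Finset.sum_div, Finset.sum_const,
            Finset.card_univ, nsmul_eq_mul]
      _ ≤ _ := mul_le_mul_of_nonneg_right (Real.exp_le_exp.2 (hT x hx)) hprod
  calc (Measure.pi fun i => gaussianReal (m i) v) S
      = ∫⁻ x in S, ENNReal.ofReal (∏ i, gaussianPDFReal (m i) v (x i)) := by
        rw [pi_gaussianReal_eq_withDensity m fun _ => hv, withDensity_apply _ hS]
    _ ≤ ∫⁻ x in S, ENNReal.ofReal (Real.exp T) *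
          ENNReal.ofReal (∏ i, gaussianPDFReal (y i) w (x i)) := setLIntegral_mono' hS hratio
    _ = ENNReal.ofReal (Real.exp T) * (Measure.pi fun i => gaussianReal (y i) w) S := by
        rw [lintegral_const_mul' _ _ ENNReal.ofReal_ne_top,
          pi_gaussianReal_eq_withDensity y fun _ => hw, withDensity_apply _ hS]
    _ ≤ ENNReal.ofReal (Real.exp T) := mul_le_of_le_one_right' prob_le_one

/-- Lower-tail bound for the squared norm of a centred Gaussian vector with i.i.d. coordinates. -/
theorem pi_gaussianReal_sum_sq_lt_le (n : ℕ) {v : ℝ≥0} (hv : v ≠ 0) {δ : ℝ} (h0 : 0 < δ) :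
    ((Measure.pi fun _ : Fin n => gaussianReal 0 v)
      {x | n * v * (1 - δ) ≤ ∑ i, x i ^ 2}ᶜ).toReal ≤ Real.exp (-(n * δ ^ 2 / 6)) := by
  have hv' : (0 : ℝ) < v := by exact_mod_cast pos_iff_ne_zero.2 hv
  set w : ℝ≥0 := v / ⟨1 + δ, by linarith⟩
  have hwv : (w : ℝ) = v / (1 + δ) := rfl
  have hw' : (0 : ℝ) < w := by rw [hwv]; positivity
  have hw : w ≠ 0 := by exact_mod_cast hw'.ne'
  refine pi_gaussianReal_toReal_le hv hw (fun _ => 0) (fun _ => 0)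
    (measurableSet_le (by fun_prop) (by fun_prop)).compl _ fun x hx => ?_
  have hx' : ∑ i, x i ^ 2 < n * v * (1 - δ) := by simpa using hx
  have hlog : Real.log (w / v) = -Real.log (1 + δ) := by
    rw [hwv, ← Real.log_inv]
    congr 1
    field_simp
  have hlb : 2 * δ / (δ + 2) ≤ Real.log (1 + δ) := Real.le_log_one_add_of_nonneg h0.le
  have hδ : δ * (1 - δ) - 2 * δ / (δ + 2) ≤ -(δ ^ 2 / 3) := by
    rw [sub_le_iff_le_add, ← sub_le_iff_le_add', le_div_iff₀ (by linarith)]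
    nlinarith [mul_nonneg (sq_nonneg δ) h0.le, sq_nonneg δ]
  have hsum : (∑ i, x i ^ 2) / (2 * w) - (∑ i, x i ^ 2) / (2 * v) ≤ n * (δ * (1 - δ)) / 2 := by
    have : (∑ i, x i ^ 2) / (2 * w) - (∑ i, x i ^ 2) / (2 * v) =
        (∑ i, x i ^ 2) * (δ / (2 * v)) := by
      rw [hwv]
      field_simp
      ring
    rw [this]
    calc _ ≤ n * v * (1 - δ) * (δ / (2 * v)) := by gcongr
      _ = _ := by field_simp
  simp only [sub_zero, Fintype.card_fin, hlog]
  have hn : (0 : ℝ) ≤ n := n.cast_nonneg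
  have := mul_le_mul_of_nonneg_left (hδ.trans' (sub_le_sub_left hlb _)) hn
  linarith

/-- A large-norm part of a mean-square ball has small probability under a centred Gaussian vector
with i.i.d. coordinates. -/
theorem pi_gaussianReal_inter_ball_le {n : ℕ} (hn : 1 ≤ n) {v : ℝ≥0} (hv : v ≠ 0) (δ : ℝ) {d : ℝ}
    (hd : 0 < d) (y : Fin n → ℝ) :
    ((Measure.pi fun _ : Fin n => gaussianReal 0 v)
      ({x | n * v * (1 - δ) ≤ ∑ i, x i ^ 2} ∩
        {x | (1 / (n : ℝ)) * ∑ i, (x i - y i) ^ 2 ≤ d})).toReal ≤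
      Real.exp (n * (δ / 2 - Real.log (v / d) / 2)) := by
  have hv' : (0 : ℝ) < v := by exact_mod_cast pos_iff_ne_zero.2 hv
  have hn' : (0 : ℝ) < n := by exact_mod_cast hn
  lift d to ℝ≥0 using hd.le
  have hw : d ≠ 0 := by exact_mod_cast hd.ne'
  refine pi_gaussianReal_toReal_le hv hw (fun _ => 0) y
    ((measurableSet_le (by fun_prop) (by fun_prop)).inter
      (measurableSet_le (by fun_prop) (by fun_prop))) _ fun x hx => ?_
  obtain ⟨hxA, hxB⟩ := hx
  simp only [Set.mem_ofPred_eq] at hxA hxB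
  simp only [sub_zero, Fintype.card_fin]
  have hlog : Real.log ((d : ℝ) / v) = -Real.log (v / d) := by rw [← Real.log_inv, inv_div]
  have hB : (∑ i, (x i - y i) ^ 2) / (2 * (d : ℝ)) ≤ n / 2 := by
    rw [one_div, inv_mul_le_iff₀ hn'] at hxB
    rw [div_le_iff₀ (by positivity)]
    linarith
  have hA : n * (1 - δ) / 2 ≤ (∑ i, x i ^ 2) / (2 * v) := by
    rw [le_div_iff₀ (by positivity)]
    linarith
  rw [hlog]
  linarith

/-- The Gaussian source with mean-square distortion is sphere-packing optimal (SPO):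
with `R(d) = max(0, (1/2)·log₂(σ²/d))`, there exist measurable sets `Aₙ ⊆ ℝⁿ` and
reals `kₙ → 0` such that `P(X⁽ⁿ⁾ ∉ Aₙ) → 0` and, for every `n ≥ 1`, `d > 0` and
`y ∈ ℝⁿ`, `P(X⁽ⁿ⁾ ∈ Aₙ ∧ (1/n)∑ (Xᵢ − yᵢ)² ≤ d) ≤ 2^{−n(R(d)+kₙ)}`. -/
theorem gaussian_source_is_SPO (σ : ℝ) (hσ : 0 < σ) :
    ∃ A : ∀ n : ℕ, Set (Fin n → ℝ), ∃ k : ℕ → ℝ,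
      (∀ n, MeasurableSet (A n)) ∧
      Tendsto k atTop (nhds 0) ∧
      Tendsto
        (fun n : ℕ =>
          ((Measure.pi fun _ : Fin n => gaussianReal 0 ⟨σ ^ 2, sq_nonneg σ⟩)
            (A n)ᶜ).toReal)
        atTop (nhds 0) ∧
      (∀ n : ℕ, 1 ≤ n → ∀ d : ℝ, 0 < d → ∀ y : Fin n → ℝ,
        ((Measure.pi fun _ : Fin n => gaussianReal 0 ⟨σ ^ 2, sq_nonneg σ⟩)
            (A n ∩ {x : Fin n → ℝ | (1 / (n : ℝ)) * ∑ i, (x i - y i) ^ 2 ≤ d})).toReal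
          ≤ 2 ^ (-(n : ℝ) *
              (max 0 ((1 / 2) * Real.logb 2 (σ ^ 2 / d)) + k n))) := by
  set v : ℝ≥0 := ⟨σ ^ 2, sq_nonneg σ⟩
  have hvσ : (v : ℝ) = σ ^ 2 := rfl
  have hv : v ≠ 0 := fun h => (pow_pos hσ 2).ne' (congrArg NNReal.toReal h)
  have hlog2 : 0 < Real.log 2 := Real.log_pos one_lt_two
  set δ : ℕ → ℝ := fun n => (n : ℝ) ^ (-(1 / 4) : ℝ) with hδdef
  have hδ0 : ∀ n, 0 ≤ δ n := fun n => Real.rpow_nonneg n.cast_nonneg _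
  have hδlim : Tendsto δ atTop (nhds 0) :=
    (tendsto_rpow_neg_atTop (by norm_num)).comp tendsto_natCast_atTop_atTop
  refine ⟨fun n => {x | n * v * (1 - δ n) ≤ ∑ i, x i ^ 2}, fun n => -(δ n / (2 * Real.log 2)),
    fun n => measurableSet_le (by fun_prop) (by fun_prop), ?_, ?_, ?_⟩
  · simpa using (hδlim.div_const (2 * Real.log 2)).neg
  · have hexp : Tendsto (fun n : ℕ => Real.exp (-((n : ℝ) ^ (1 / 2 : ℝ) / 6))) atTop (nhds 0) :=
      Real.tendsto_exp_neg_atTop_nhds_zero.comp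
        (((tendsto_rpow_atTop (by norm_num)).comp tendsto_natCast_atTop_atTop).atTop_div_const
          (by norm_num))
    refine squeeze_zero' (Eventually.of_forall fun n => ENNReal.toReal_nonneg) ?_ hexp
    filter_upwards [eventually_ge_atTop 1] with n hn
    have hn' : (0 : ℝ) < n := by exact_mod_cast hn
    have hsq : n * δ n ^ 2 = (n : ℝ) ^ (1 / 2 : ℝ) := by
      rw [hδdef, ← Real.rpow_natCast, ← Real.rpow_mul hn'.le, ← Real.rpow_one_add' hn'.le] <;>
        norm_num
    rw [← hsq]
    exact pi_gaussianReal_sum_sq_lt_le n hv (Real.rpow_pos_of_pos hn' _)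
  · intro n hn d hd y
    have hn' : (0 : ℝ) ≤ n := n.cast_nonneg
    rw [Real.rpow_def_of_pos two_pos]
    rcases le_total 0 ((1 / 2) * Real.logb 2 (σ ^ 2 / d)) with h | h
    · rw [max_eq_right h]
      refine (pi_gaussianReal_inter_ball_le hn hv (δ n) hd y).trans_eq (congrArg Real.exp ?_)
      rw [hvσ, Real.logb]
      field_simp
      ring
    · rw [max_eq_left h, zero_add]
      refine (ENNReal.toReal_le_of_le_ofReal zero_le_one (by simpa using prob_le_one)).trans
        (Real.one_le_exp ?_)
      rw [neg_mul_neg]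
      have := hδ0 n
      positivity
end
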